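/- Let T = (V,E) be a finite tree with at least two vertices, with bipartition classes A and B, and let K : V → ℝ satisfy Σ_{a∈A} K(a) = Σ_{b∈B} K(b). Then the unique solution c : E → ℝ of the constraint system for K satisfies ‖c‖₂² ≤ ‖K‖² · |V|² · d̄, where d̄ is the diameter of T. -/

import Mathlib

open scoped Classical
noncomputable section

namespace CS

variable {V : Type*} [Fintype V] [DecidableEq V]

/-- `c`, a real function on the edges of `H`, solves the constraint system for `K`:
for every vertex `v`, the sum of `c` over the edges incident to `v` equals `-K v`. -/
def Solves (H : SimpleGraph V) (K : V → ℝ) (c : H.edgeFinset → ℝ) : Prop :=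
  ∀ v : V, ∑ e : H.edgeFinset, (if v ∈ (e : Sym2 V) then c e else 0) = -K v

/-- `‖c‖₂²`, the sum of squares of the values of `c` over the edges. -/
def norm2 (H : SimpleGraph V) (c : H.edgeFinset → ℝ) : ℝ :=
  ∑ e : H.edgeFinset, c e ^ 2

/-- `‖K‖ = max_v |K v|`. -/
def kmax (K : V → ℝ) : ℝ := ⨆ v, |K v|

/-- The descendants of `u` in the tree `G` rooted at `v`: the vertices whose
(unique) path to the root `v` passes through `u` (`u` being its own descendant). -/
def descendants (G : SimpleGraph V) (v u : V) : Finset V :=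
  Finset.univ.filter fun w => ∀ p : G.Walk w v, p.IsPath → u ∈ p.support

/-- The vertices cut off from the root `r` when the edge `e` is removed from `G`. -/
def cutOff (G : SimpleGraph V) (r : V) (e : Sym2 V) : Finset V :=
  Finset.univ.filter fun w => ¬ (G.deleteEdges {e}).Reachable r w

/-- The sign of a vertex relative to the class `A`. -/
def classSign (A : Finset V) (v : V) : ℝ := if v ∈ A then 1 else -1

omit [Fintype V] in
lemma abs_classSign (A : Finset V) (v : V) : |classSign A v| = 1 := by
  unfold classSign
  split_ifs <;> simp

omit [DecidableEq V] in
lemma abs_le_kmax (K : V → ℝ) (v : V) : |K v| ≤ kmax K :=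
  le_ciSup (f := fun v => |K v|) (Set.finite_range _).bddAbove v

lemma mem_cutOff {G : SimpleGraph V} {r w : V} {e : Sym2 V} :
    w ∈ cutOff G r e ↔ ¬ (G.deleteEdges {e}).Reachable r w := by
  simp [cutOff]

lemma mem_cutOff_iff_of_adj {G : SimpleGraph V} {r a b : V} {e : Sym2 V}
    (hab : G.Adj a b) (hne : s(a, b) ≠ e) : a ∈ cutOff G r e ↔ b ∈ cutOff G r e := by
  have h : (G.deleteEdges {e}).Adj a b := by simp [SimpleGraph.deleteEdges_adj, hab, hne]
  rw [mem_cutOff, mem_cutOff, not_iff_not]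
  exact ⟨fun hr => hr.trans h.reachable, fun hr => hr.trans h.symm.reachable⟩

omit [Fintype V] in
lemma reachable_deleteEdges_or {G : SimpleGraph V} {r z : V} (x y : V) (p : G.Walk r z) :
    (G.deleteEdges {s(x, y)}).Reachable r z ∨ (G.deleteEdges {s(x, y)}).Reachable r x ∨
      (G.deleteEdges {s(x, y)}).Reachable r y := by
  induction p with
  | nil => exact Or.inl (SimpleGraph.Reachable.refl _)
  | @cons u v w huv p ih =>
    by_cases he : s(u, v) = s(x, y)
    · rcases Sym2.eq_iff.mp he with ⟨rfl, rfl⟩ | ⟨rfl, rfl⟩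
      · exact Or.inr (Or.inl (SimpleGraph.Reachable.refl _))
      · exact Or.inr (Or.inr (SimpleGraph.Reachable.refl _))
    · have h : (G.deleteEdges {s(x, y)}).Reachable u v :=
        SimpleGraph.Adj.reachable (by simp [SimpleGraph.deleteEdges_adj, huv, he])
      exact ih.imp h.trans (Or.imp h.trans h.trans)

/-- An edge of a tree has exactly one endpoint cut off from the root by its removal. -/
lemma mem_cutOff_iff_notMem {T : SimpleGraph V} (hT : T.IsTree) (r : V) {x y : V}
    (hxy : T.Adj x y) : x ∈ cutOff T r s(x, y) ↔ y ∉ cutOff T r s(x, y) := by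
  have hbridge : ¬ (T.deleteEdges {s(x, y)}).Reachable x y :=
    SimpleGraph.isBridge_iff.mp (SimpleGraph.isAcyclic_iff_forall_adj_isBridge.mp hT.isAcyclic hxy)
  obtain ⟨p⟩ := hT.connected.preconnected r x
  have h := reachable_deleteEdges_or x y p
  rw [mem_cutOff, mem_cutOff, not_not]
  constructor
  · tauto
  · exact fun hy hx => hbridge (hx.symm.trans hy)

lemma card_filter_mem_cutOff_le {T : SimpleGraph V} (hT : T.IsTree) (r w : V) :
    (Finset.univ.filter fun e : T.edgeFinset => w ∈ cutOff T r e).card ≤ T.diam := by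
  have : Nonempty V := ⟨r⟩
  obtain ⟨p, hp⟩ := hT.connected.exists_walk_length_eq_dist r w
  have hsub : (Finset.univ.filter fun e : T.edgeFinset => w ∈ cutOff T r e).map
      (Function.Embedding.subtype _) ⊆ p.edges.toFinset := by
    intro e he
    simp only [Finset.mem_map, Finset.mem_filter, Finset.mem_univ, true_and,
      Function.Embedding.subtype_apply] at he
    obtain ⟨e, he, rfl⟩ := he
    obtain ⟨⟨x, y⟩, hxy⟩ := e
    by_contra hmem
    exact mem_cutOff.mp he (SimpleGraph.reachable_deleteEdges_iff_exists_walk.mpr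
      ⟨p, by simpa using hmem⟩)
  calc _ ≤ p.edges.toFinset.card := by simpa using Finset.card_le_card hsub
    _ ≤ T.dist r w := by
      rw [← hp, ← p.length_edges]
      exact List.toFinset_card_le _
    _ ≤ T.diam := SimpleGraph.dist_le_diam
      (SimpleGraph.connected_iff_ediam_ne_top.mp hT.connected)

omit [Fintype V] in
/-- The total of `s` over the endpoints of the edge `s(a, b)` lying in `D`. -/
lemma sum_endpoints (D : Finset V) (s : V → ℝ) {a b : V} (hab : a ≠ b) :
    ∑ w ∈ D, (if w ∈ s(a, b) then s w else 0) =
      (if a ∈ D then s a else 0) + (if b ∈ D then s b else 0) := by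
  rw [← Finset.sum_ite_eq' D a s, ← Finset.sum_ite_eq' D b s, ← Finset.sum_add_distrib]
  refine Finset.sum_congr rfl fun w _ => ?_
  simp only [Sym2.mem_iff]
  by_cases h1 : w = a <;> by_cases h2 : w = b <;> simp_all

omit [Fintype V] in
lemma classSign_eq_neg {T : SimpleGraph V} {A B : Finset V}
    (hAB : ∀ v : V, v ∈ A ↔ v ∉ B)
    (hbip : ∀ v w : V, T.Adj v w → ((v ∈ A ∧ w ∈ B) ∨ (v ∈ B ∧ w ∈ A)))
    {a b : V} (hab : T.Adj a b) : classSign A a = - classSign A b := by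
  have h := hbip a b hab
  have ha := hAB a
  have hb := hAB b
  unfold classSign
  split_ifs
  · tauto
  · norm_num
  · norm_num
  · tauto

/-- The constraints, weighted by a function `s` and added over a vertex set `D`. -/
lemma Solves.sum_mul {H : SimpleGraph V} {K : V → ℝ} {c : H.edgeFinset → ℝ} (hc : Solves H K c)
    (D : Finset V) (s : V → ℝ) :
    ∑ w ∈ D, s w * K w =
      - ∑ e : H.edgeFinset, c e * ∑ w ∈ D, (if w ∈ (e : Sym2 V) then s w else 0) := by
  have h : ∀ w, K w = - ∑ e : H.edgeFinset, (if w ∈ (e : Sym2 V) then c e else 0) :=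
    fun w => by rw [hc w, neg_neg]
  simp_rw [h, mul_neg, Finset.sum_neg_distrib, Finset.mul_sum]
  rw [Finset.sum_comm]
  refine congrArg _ (Finset.sum_congr rfl fun e _ => Finset.sum_congr rfl fun w _ => ?_)
  split_ifs <;> ring

/-- The value of a solution on an edge is determined, up to sign, by the signed sum of `K` over the
vertices cut off by that edge. -/
lemma Solves.abs_sum_cutOff {T : SimpleGraph V} {A B : Finset V} {K : V → ℝ}
    (hT : T.IsTree) (hAB : ∀ v : V, v ∈ A ↔ v ∉ B)
    (hbip : ∀ v w : V, T.Adj v w → ((v ∈ A ∧ w ∈ B) ∨ (v ∈ B ∧ w ∈ A)))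
    {c : T.edgeFinset → ℝ} (hc : Solves T K c) (r : V) (e : T.edgeFinset) :
    |c e| = |∑ w ∈ cutOff T r e, classSign A w * K w| := by
  rw [hc.sum_mul, abs_neg, Finset.sum_eq_single e]
  · obtain ⟨⟨x, y⟩, hxy⟩ := e
    have hadj : T.Adj x y := by simpa using hxy
    have hcut := mem_cutOff_iff_notMem hT r hadj
    change _ = |_ * ∑ w ∈ cutOff T r s(x, y), (if w ∈ s(x, y) then classSign A w else 0)|
    rw [sum_endpoints _ _ hadj.ne, abs_mul]
    by_cases hy : y ∈ cutOff T r s(x, y)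
    · simp [hcut, hy, abs_classSign]
    · simp [hcut, hy, abs_classSign]
  · intro f _ hfe
    obtain ⟨⟨a, b⟩, hab⟩ := f
    have hadj : T.Adj a b := by simpa using hab
    have hcut := mem_cutOff_iff_of_adj (r := r) hadj
      (fun h => hfe (Subtype.ext h) : s(a, b) ≠ (e : Sym2 V))
    change _ * ∑ w ∈ cutOff T r e, (if w ∈ s(a, b) then classSign A w else 0) = 0
    rw [sum_endpoints _ _ hadj.ne, classSign_eq_neg hAB hbip hadj]
    by_cases hb : b ∈ cutOff T r e <;> simp [hcut, hb]
  · simp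

/-- The linear map sending an edge function to minus its vertex sums. -/
def vertexSum (H : SimpleGraph V) : (H.edgeFinset → ℝ) →ₗ[ℝ] (V → ℝ) :=
  LinearMap.pi fun v => -∑ e : H.edgeFinset, if v ∈ (e : Sym2 V) then LinearMap.proj e else 0

lemma solves_iff_vertexSum_eq {H : SimpleGraph V} {K : V → ℝ} {c : H.edgeFinset → ℝ} :
    Solves H K c ↔ vertexSum H c = K := by
  rw [funext_iff]
  refine forall_congr' fun v => ?_
  have h : vertexSum H c v = -∑ e : H.edgeFinset, (if v ∈ (e : Sym2 V) then c e else 0) := by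
    simp only [vertexSum, LinearMap.pi_apply, LinearMap.neg_apply, LinearMap.sum_apply]
    refine congrArg _ (Finset.sum_congr rfl fun e _ => ?_)
    split_ifs <;> simp
  rw [h, neg_eq_iff_eq_neg]

lemma vertexSum_injective {T : SimpleGraph V} {A B : Finset V}
    (hT : T.IsTree) (hAB : ∀ v : V, v ∈ A ↔ v ∉ B)
    (hbip : ∀ v w : V, T.Adj v w → ((v ∈ A ∧ w ∈ B) ∨ (v ∈ B ∧ w ∈ A))) :
    Function.Injective (vertexSum T) := by
  rw [injective_iff_map_eq_zero]
  intro c hc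
  obtain ⟨r⟩ := hT.connected.nonempty
  ext e
  have h := (solves_iff_vertexSum_eq.mpr hc).abs_sum_cutOff hT hAB hbip r e
  simpa using h

/-- The signed total of a vertex function. -/
def signedSum (A : Finset V) : Module.Dual ℝ (V → ℝ) :=
  ∑ v, classSign A v • LinearMap.proj v

lemma signedSum_apply (A : Finset V) (K : V → ℝ) :
    signedSum A K = ∑ v, classSign A v * K v := by
  simp [signedSum]

lemma signedSum_eq_sub {A B : Finset V} (hAB : ∀ v : V, v ∈ A ↔ v ∉ B) (K : V → ℝ) :
    signedSum A K = ∑ a ∈ A, K a - ∑ b ∈ B, K b := by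
  have hB : B = Aᶜ := by
    ext v
    simp [hAB]
  rw [signedSum_apply, hB, ← Finset.sum_add_sum_compl A, sub_eq_add_neg, ← Finset.sum_neg_distrib]
  congr 1
  · exact Finset.sum_congr rfl fun v hv => by simp [classSign, hv]
  · exact Finset.sum_congr rfl fun v hv => by simp [classSign, Finset.mem_compl.mp hv]

lemma signedSum_ne_zero [Nonempty V] (A : Finset V) : signedSum A ≠ 0 := by
  intro h
  obtain ⟨r⟩ := ‹Nonempty V›
  have h1 := signedSum_apply A (Pi.single r 1)
  have h2 := abs_classSign A r
  have h3 : classSign A r = 0 := by simpa [h, Pi.single_apply] using h1.symm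
  simp [h3] at h2

lemma range_vertexSum {T : SimpleGraph V} {A B : Finset V}
    (hT : T.IsTree) (hAB : ∀ v : V, v ∈ A ↔ v ∉ B)
    (hbip : ∀ v w : V, T.Adj v w → ((v ∈ A ∧ w ∈ B) ∨ (v ∈ B ∧ w ∈ A))) :
    LinearMap.range (vertexSum T) = LinearMap.ker (signedSum A) := by
  have : Nonempty V := hT.connected.nonempty
  apply Submodule.eq_of_le_of_finrank_eq
  · rintro _ ⟨c, rfl⟩
    rw [LinearMap.mem_ker, signedSum_apply,
      (solves_iff_vertexSum_eq.mpr rfl : Solves T (vertexSum T c) c).sum_mul, neg_eq_zero]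
    refine Finset.sum_eq_zero fun e _ => ?_
    obtain ⟨⟨a, b⟩, hab⟩ := e
    have hadj : T.Adj a b := by simpa using hab
    change _ * ∑ w, (if w ∈ s(a, b) then classSign A w else 0) = 0
    rw [sum_endpoints _ _ hadj.ne, classSign_eq_neg hAB hbip hadj]
    simp
  · have h1 := Module.Dual.finrank_ker_add_one_of_ne_zero (signedSum_ne_zero A)
    have h2 := hT.card_edgeFinset
    rw [LinearMap.finrank_range_of_inj (vertexSum_injective hT hAB hbip)]
    simp only [Module.finrank_fintype_fun_eq_card, Fintype.card_coe] at h1 ⊢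
    convert Nat.add_right_cancel (h2.trans h1.symm)

lemma Solves.norm2_le {T : SimpleGraph V} {A B : Finset V} {K : V → ℝ}
    (hT : T.IsTree) (hAB : ∀ v : V, v ∈ A ↔ v ∉ B)
    (hbip : ∀ v w : V, T.Adj v w → ((v ∈ A ∧ w ∈ B) ∨ (v ∈ B ∧ w ∈ A)))
    {c : T.edgeFinset → ℝ} (hc : Solves T K c) :
    norm2 T c ≤ kmax K ^ 2 * (Fintype.card V : ℝ) ^ 2 * (T.diam : ℝ) := by
  obtain ⟨r⟩ := hT.connected.nonempty
  have habs : ∀ e, |c e| ≤ kmax K * (cutOff T r e).card := by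
    intro e
    rw [hc.abs_sum_cutOff hT hAB hbip r e]
    refine (Finset.abs_sum_le_sum_abs _ _).trans ?_
    refine (Finset.sum_le_card_nsmul _ _ (kmax K) fun w _ => ?_).trans_eq ?_
    · rw [abs_mul, abs_classSign, one_mul]
      exact abs_le_kmax K w
    · rw [nsmul_eq_mul, mul_comm]
  have hsq : ∀ e, c e ^ 2 ≤ kmax K ^ 2 * Fintype.card V * (cutOff T r e).card := by
    intro e
    have hle : ((cutOff T r e).card : ℝ) ≤ Fintype.card V := by
      exact_mod_cast Finset.card_le_univ _
    calc c e ^ 2 = |c e| ^ 2 := (sq_abs _).symm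
      _ ≤ (kmax K * (cutOff T r e).card) ^ 2 := by gcongr; exact habs e
      _ = kmax K ^ 2 * (cutOff T r e).card * (cutOff T r e).card := by ring
      _ ≤ _ := by gcongr
  have hcount : ∑ e : T.edgeFinset, (cutOff T r e).card ≤ Fintype.card V * T.diam := by
    have hcomm := Finset.sum_card_bipartiteAbove_eq_sum_card_bipartiteBelow
      (s := (Finset.univ : Finset T.edgeFinset)) (t := (Finset.univ : Finset V))
      (fun (e : T.edgeFinset) w => w ∈ cutOff T r e)
    simp only [Finset.bipartiteAbove, Finset.bipartiteBelow, Finset.filter_univ_mem] at hcomm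
    rw [hcomm]
    refine (Finset.sum_le_card_nsmul _ _ T.diam fun w _ =>
      card_filter_mem_cutOff_le hT r w).trans_eq ?_
    simp
  calc norm2 T c ≤ ∑ e : T.edgeFinset, kmax K ^ 2 * Fintype.card V * (cutOff T r e).card :=
        Finset.sum_le_sum fun e _ => hsq e
    _ = kmax K ^ 2 * Fintype.card V * ((∑ e : T.edgeFinset, (cutOff T r e).card : ℕ) : ℝ) := by
        rw [← Finset.mul_sum, Nat.cast_sum]
    _ ≤ kmax K ^ 2 * Fintype.card V * ((Fintype.card V * T.diam : ℕ) : ℝ) := by gcongr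
    _ = _ := by push_cast; ring

/-- For a finite tree `T` with at least two vertices, bipartition classes
`A, B` and `K : V → ℝ` with `∑_A K = ∑_B K`, the unique solution `c` of the constraint
system for `K` satisfies `‖c‖₂² ≤ ‖K‖²·|V|²·d̄`, where `d̄` is the diameter of `T`. -/
theorem statement10 (T : SimpleGraph V) (A B : Finset V) (K : V → ℝ)
    (htree : T.IsTree) (hcard : 2 ≤ Fintype.card V)
    (hAB : ∀ v : V, v ∈ A ↔ v ∉ B)
    (hbip : ∀ v w : V, T.Adj v w → ((v ∈ A ∧ w ∈ B) ∨ (v ∈ B ∧ w ∈ A)))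
    (hK : ∑ a ∈ A, K a = ∑ b ∈ B, K b) :
    (∃! c : T.edgeFinset → ℝ, Solves T K c) ∧
      ∀ c : T.edgeFinset → ℝ, Solves T K c →
        norm2 T c ≤ kmax K ^ 2 * (Fintype.card V : ℝ) ^ 2 * (T.diam : ℝ) := by
  refine ⟨?_, fun c hc => hc.norm2_le htree hAB hbip⟩
  have hmem : K ∈ LinearMap.range (vertexSum T) := by
    rw [range_vertexSum htree hAB hbip, LinearMap.mem_ker, signedSum_eq_sub hAB, hK, sub_self]
  obtain ⟨c, hc⟩ := hmem
  refine ⟨c, solves_iff_vertexSum_eq.mpr hc, fun d hd => ?_⟩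
  exact vertexSum_injective htree hAB hbip ((solves_iff_vertexSum_eq.mp hd).trans hc.symm)

end CS
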